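/- Concentration on the critical curve (Theorem 3.2): Assume α > −2 and that g_{α,h} attains its maximum over [0,1] at exactly two points 0 < u₁* < u₂* < 1. Then for all sufficiently small ε > 0 there exist τ > 0 and N ∈ ℕ such that for all n ≥ N, ℙ_{n;α,h}( { x ∈ 𝒜_n : 6·T_n(x)/n³ ∈ J(ε) } ) ≥ 1 − exp(−τ·n²), where J(ε) = ((u₁*)³−ε, (u₁*)³+ε) ∪ ((u₂*)³−ε, (u₂*)³+ε). -/

import Mathlib

open scoped Classical

/-- Number of triangles in the graph `G` on `n` vertices. -/
noncomputable def triCount {n : ℕ} (G : SimpleGraph (Fin n)) : ℕ :=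
  Nat.card {s : Finset (Fin n) // G.IsNClique 3 s}

/-- Number of edges of `G`. -/
noncomputable def edgeCount {n : ℕ} (G : SimpleGraph (Fin n)) : ℕ :=
  Nat.card G.edgeSet

/-- Gibbs weight `exp((α/n)·T_n(G) + h·E_n(G))` of the edge-triangle model. -/
noncomputable def gibbsWeight (α h : ℝ) {n : ℕ} (G : SimpleGraph (Fin n)) : ℝ :=
  Real.exp (α / n * triCount G + h * edgeCount G)

/-- The edge-triangle Gibbs probability of a set `A` of graphs on `n` vertices. -/
noncomputable def gibbsProb (α h : ℝ) (n : ℕ) (A : Set (SimpleGraph (Fin n))) : ℝ :=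
  (∑ G : SimpleGraph (Fin n), if G ∈ A then gibbsWeight α h G else 0) /
  (∑ G : SimpleGraph (Fin n), gibbsWeight α h G)

/-- The energy function `g_{α,h}(u) = (α/6)u³ + (h/2)u − I(u)/2`. -/
noncomputable def gFun (α h u : ℝ) : ℝ :=
  α / 6 * u ^ 3 + h / 2 * u - (u * Real.log u + (1 - u) * Real.log (1 - u)) / 2

section

open Finset
open scoped BigOperators

/-! ### The energy function -/

lemma gFun_eq_binEntropy (α h u : ℝ) :
    gFun α h u = α / 6 * u ^ 3 + h / 2 * u + Real.binEntropy u / 2 := by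
  rw [gFun, Real.binEntropy_eq_negMulLog_add_negMulLog_one_sub, Real.negMulLog, Real.negMulLog]
  ring

lemma continuous_gFun (α h : ℝ) : Continuous (gFun α h) := by
  have : gFun α h = fun u => α / 6 * u ^ 3 + h / 2 * u + Real.binEntropy u / 2 :=
    funext (gFun_eq_binEntropy α h)
  rw [this]
  fun_prop

/-- Two distinct maximizers of the energy function force a positive triangle parameter. -/
lemma pos_of_two_maximizers {α h u₁ u₂ : ℝ} (h0 : 0 < u₁) (h12 : u₁ < u₂) (h1 : u₂ < 1)
    (hmax : ∀ u ∈ Set.Icc (0 : ℝ) 1, gFun α h u ≤ gFun α h u₁)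
    (heq : gFun α h u₂ = gFun α h u₁) : 0 < α := by
  by_contra! hα
  have hmid := hmax (1 / 2 * u₁ + 1 / 2 * u₂) ⟨by linarith, by linarith⟩
  have hconc := Real.strictConcave_binEntropy.2 (show u₁ ∈ Set.Icc 0 1 from ⟨h0.le, by linarith⟩)
    (show u₂ ∈ Set.Icc 0 1 from ⟨by linarith, h1.le⟩) h12.ne
    (show (0 : ℝ) < 1 / 2 by norm_num) (show (0 : ℝ) < 1 / 2 by norm_num) (by norm_num)
  simp only [smul_eq_mul] at hconc
  simp only [gFun_eq_binEntropy] at hmid heq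
  have hcube : (1 / 2 * u₁ + 1 / 2 * u₂) ^ 3 ≤ 1 / 2 * u₁ ^ 3 + 1 / 2 * u₂ ^ 3 := by
    have : 1 / 2 * u₁ ^ 3 + 1 / 2 * u₂ ^ 3 - (1 / 2 * u₁ + 1 / 2 * u₂) ^ 3
        = 3 / 8 * (u₁ + u₂) * (u₁ - u₂) ^ 2 := by ring
    have : 0 ≤ 3 / 8 * (u₁ + u₂) * (u₁ - u₂) ^ 2 := by
      have := h0.trans h12
      positivity
    linarith
  nlinarith [mul_le_mul_of_nonneg_left hcube (neg_nonneg.2 hα)]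

/-- Away from its zeros, a bounded function is controlled by the energy deficit. -/
lemma exists_le_add_mul_deficit {α h u₁ u₂ : ℝ}
    (h0 : 0 < u₁) (h12 : u₁ < u₂) (h1 : u₂ < 1)
    (hmax : ∀ u ∈ Set.Icc (0 : ℝ) 1, gFun α h u ≤ gFun α h u₁)
    (huniq : ∀ u ∈ Set.Icc (0 : ℝ) 1, gFun α h u = gFun α h u₁ → u = u₁ ∨ u = u₂)
    {η : ℝ} (hη : 0 < η) :
    ∃ C, 0 ≤ C ∧ ∀ u ∈ Set.Icc (0 : ℝ) 1,
      |(u - u₁) * (u - u₂)| ≤ η + C * (gFun α h u₁ - gFun α h u) := by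
  set K : Set ℝ := Set.Icc 0 1 ∩ {u | η ≤ |(u - u₁) * (u - u₂)|} with hK
  have hKc : IsCompact K :=
    isCompact_Icc.inter_right (isClosed_le continuous_const (by fun_prop))
  have hle : ∀ u ∈ Set.Icc (0 : ℝ) 1, |(u - u₁) * (u - u₂)| ≤ 1 := fun u hu => by
    rw [abs_mul]
    exact mul_le_one₀ (abs_le.2 ⟨by linarith [hu.1], by linarith [hu.2]⟩) (abs_nonneg _)
      (abs_le.2 ⟨by linarith [hu.1], by linarith [hu.2]⟩)
  rcases K.eq_empty_or_nonempty with hKe | hKn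
  · refine ⟨0, le_rfl, fun u hu => ?_⟩
    by_contra! hlt
    have : u ∈ K := ⟨hu, by simpa using hlt.le⟩
    simp [hKe] at this
  · obtain ⟨v, hv, hvmax⟩ := hKc.exists_isMaxOn hKn (continuous_gFun α h).continuousOn
    have hpos : 0 < gFun α h u₁ - gFun α h v := by
      refine sub_pos.2 (lt_of_le_of_ne (hmax v hv.1) fun he => ?_)
      have h2 : η ≤ |(v - u₁) * (v - u₂)| := hv.2
      rcases huniq v hv.1 he with rfl | rfl <;> simp at h2 <;> linarith
    refine ⟨(gFun α h u₁ - gFun α h v)⁻¹, by positivity, fun u hu => ?_⟩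
    by_cases hu' : η ≤ |(u - u₁) * (u - u₂)|
    · have h3 : gFun α h u ≤ gFun α h v := hvmax ⟨hu, hu'⟩
      have h4 : 1 ≤ (gFun α h u₁ - gFun α h v)⁻¹ * (gFun α h u₁ - gFun α h u) := by
        rw [inv_mul_eq_div, one_le_div hpos]
        linarith
      linarith [hle u hu]
    · have := mul_nonneg (inv_nonneg.2 hpos.le) (sub_nonneg.2 (hmax u hu))
      linarith

/-! ### Stability of the variational problem -/

/-- Triangle density of a weighted graph. -/
noncomputable def triDensity {n : ℕ} (p : Fin n → Fin n → ℝ) : ℝ :=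
  𝔼 i, 𝔼 j, 𝔼 k, p i j * p j k * p i k

/-- Energy functional of a weighted graph. -/
noncomputable def energy (α h : ℝ) {n : ℕ} (p : Fin n → Fin n → ℝ) : ℝ :=
  α / 6 * triDensity p + h / 2 * (𝔼 i, 𝔼 j, p i j) + (𝔼 i, 𝔼 j, Real.binEntropy (p i j)) / 2

section Expect

variable {n : ℕ}

lemma expect_mono₂ {f g : Fin n → Fin n → ℝ} (hfg : ∀ i j, f i j ≤ g i j) :
    𝔼 i, 𝔼 j, f i j ≤ 𝔼 i, 𝔼 j, g i j :=
  expect_le_expect fun i _ => expect_le_expect fun j _ => hfg i j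

lemma expect_mono₃ {f g : Fin n → Fin n → Fin n → ℝ} (hfg : ∀ i j k, f i j k ≤ g i j k) :
    𝔼 i, 𝔼 j, 𝔼 k, f i j k ≤ 𝔼 i, 𝔼 j, 𝔼 k, g i j k :=
  expect_le_expect fun i _ => expect_mono₂ fun j k => hfg i j k

lemma defect_nonneg {p : Fin n → Fin n → ℝ} (hp : ∀ i j, p i j ∈ Set.Icc (0 : ℝ) 1) :
    0 ≤ 𝔼 i, 𝔼 j, 𝔼 k, (p i j ^ 3 + p j k ^ 3 + p i k ^ 3 - 3 * (p i j * p j k * p i k)) :=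
  expect_nonneg fun i _ => expect_nonneg fun j _ => expect_nonneg fun k _ => by
    have := (hp i j).1; have := (hp j k).1; have := (hp i k).1
    have : p i j ^ 3 + p j k ^ 3 + p i k ^ 3 - 3 * (p i j * p j k * p i k)
      = (p i j + p j k + p i k) / 2
        * ((p i j - p j k) ^ 2 + (p j k - p i k) ^ 2 + (p i j - p i k) ^ 2) := by ring
    rw [this]
    positivity

variable [NeZero n]

/-- If entries along paths are close on average, then all entries are close to their mean. -/
lemma variance_le_of_path (p : Fin n → Fin n → ℝ) :
    𝔼 i, 𝔼 j, (p i j - 𝔼 i, 𝔼 j, p i j) ^ 2 ≤ 2 * 𝔼 i, 𝔼 j, 𝔼 k, (p i j - p j k) ^ 2 := by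
  set m := 𝔼 i, 𝔼 j, p i j with hm
  have key : 𝔼 i, 𝔼 j, 𝔼 k, 𝔼 l, (p i j - p k l) ^ 2
      ≤ 𝔼 i, 𝔼 j, 𝔼 k, 𝔼 l, (2 * (p i j - p j k) ^ 2 + 2 * (p j k - p k l) ^ 2) :=
    expect_mono₂ fun i j => expect_mono₂ fun k l => by
      nlinarith [sq_nonneg ((p i j - p j k) - (p j k - p k l))]
  have hR : 𝔼 i, 𝔼 j, 𝔼 k, 𝔼 l, (2 * (p i j - p j k) ^ 2 + 2 * (p j k - p k l) ^ 2)
      = 4 * 𝔼 i, 𝔼 j, 𝔼 k, (p i j - p j k) ^ 2 := by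
    simp only [expect_add_distrib, ← mul_expect, Fintype.expect_const]
    ring
  have hL : ∀ q : Fin n → Fin n → ℝ, 𝔼 i, 𝔼 j, q i j = 0 →
      𝔼 i, 𝔼 j, 𝔼 k, 𝔼 l, (q i j - q k l) ^ 2 = 2 * 𝔼 i, 𝔼 j, q i j ^ 2 := fun q hq => by
    have h1 : ∀ i j k l, (q i j - q k l) ^ 2
        = q i j ^ 2 + q k l ^ 2 - 2 * q i j * q k l := fun i j k l => by ring
    simp only [h1, expect_add_distrib, expect_sub_distrib, ← mul_expect, Fintype.expect_const, hq]
    simp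
    ring
  have hL' := hL (fun i j => p i j - m) (by
    simp only [expect_sub_distrib, Fintype.expect_const, ← hm, sub_self])
  simp only [sub_sub_sub_cancel_right] at hL'
  linarith

lemma expect_sq_sub_mean (p : Fin n → Fin n → ℝ) :
    𝔼 i, 𝔼 j, (p i j - 𝔼 i, 𝔼 j, p i j) ^ 2
      = (𝔼 i, 𝔼 j, p i j ^ 2) - (𝔼 i, 𝔼 j, p i j) ^ 2 := by
  set m := 𝔼 i, 𝔼 j, p i j with hm
  have h1 : ∀ i j, (p i j - m) ^ 2 = p i j ^ 2 - (2 * m) * p i j + m ^ 2 := fun i j => by ring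
  simp only [h1, expect_add_distrib, expect_sub_distrib, ← mul_expect, Fintype.expect_const, ← hm]
  ring

/-- The triangle density is close to the cube of the mean if the variance is small. -/
lemma abs_triDensity_sub_cube_le {p : Fin n → Fin n → ℝ} (hp : ∀ i j, p i j ∈ Set.Icc (0 : ℝ) 1)
    {m : ℝ} (hm : m ∈ Set.Icc (0 : ℝ) 1) {c : ℝ} (hc : 0 < c) :
    |triDensity p - m ^ 3| ≤ 3 * (c + c⁻¹ * 𝔼 i, 𝔼 j, (p i j - m) ^ 2) := by
  have hdev : ∀ x : ℝ, |x - m| ≤ c + c⁻¹ * (x - m) ^ 2 := fun x => by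
    rw [← sq_abs (x - m), inv_mul_eq_div, ← sub_le_iff_le_add', le_div_iff₀ hc]
    nlinarith [sq_nonneg (|x - m| - c), abs_nonneg (x - m)]
  have hprod : ∀ a ∈ Set.Icc (0 : ℝ) 1, ∀ b ∈ Set.Icc (0 : ℝ) 1, ∀ d ∈ Set.Icc (0 : ℝ) 1,
      |a * b * d - m ^ 3| ≤ |a - m| + |b - m| + |d - m| := by
    intro a ha b hb d hd
    have : a * b * d - m ^ 3 = (a - m) * (b * d) + (b - m) * (m * d) + (d - m) * (m * m) := by ring
    rw [this]
    have aux : ∀ x y z : ℝ, y ∈ Set.Icc (0 : ℝ) 1 → z ∈ Set.Icc (0 : ℝ) 1 →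
        |x * (y * z)| ≤ |x| := fun x y z hy hz => by
      rw [abs_mul, abs_of_nonneg (mul_nonneg hy.1 hz.1)]
      exact mul_le_of_le_one_right (abs_nonneg _) (mul_le_one₀ hy.2 hz.1 hz.2)
    refine (abs_add_three _ _ _).trans ?_
    refine add_le_add (add_le_add ?_ ?_) ?_ <;> apply aux <;> assumption
  have hb : ∀ i j k, |p i j * p j k * p i k - m ^ 3| ≤ 3 * c + c⁻¹ * (p i j - m) ^ 2
      + c⁻¹ * (p j k - m) ^ 2 + c⁻¹ * (p i k - m) ^ 2 := fun i j k => by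
    linarith [hprod _ (hp i j) _ (hp j k) _ (hp i k), hdev (p i j), hdev (p j k), hdev (p i k)]
  have hsum : 𝔼 i, 𝔼 j, 𝔼 k, (3 * c + c⁻¹ * (p i j - m) ^ 2
      + c⁻¹ * (p j k - m) ^ 2 + c⁻¹ * (p i k - m) ^ 2)
      = 3 * (c + c⁻¹ * 𝔼 i, 𝔼 j, (p i j - m) ^ 2) := by
    simp only [expect_add_distrib, ← mul_expect, Fintype.expect_const]
    ring
  have hconst : triDensity p - m ^ 3 = 𝔼 i, 𝔼 j, 𝔼 k, (p i j * p j k * p i k - m ^ 3) := by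
    simp only [expect_sub_distrib, Fintype.expect_const, triDensity]
  rw [← hsum, hconst, abs_le, ← expect_neg_distrib]
  simp only [← expect_neg_distrib]
  exact ⟨expect_mono₃ fun i j k => (abs_le.1 (hb i j k)).1,
    expect_mono₃ fun i j k => (abs_le.1 (hb i j k)).2⟩

/-- The deficit of the energy splits into a pointwise and a structural part. -/
lemma energy_eq (α h : ℝ) (p : Fin n → Fin n → ℝ) :
    energy α h p = (𝔼 i, 𝔼 j, gFun α h (p i j)) - α / 18 *
      𝔼 i, 𝔼 j, 𝔼 k, (p i j ^ 3 + p j k ^ 3 + p i k ^ 3 - 3 * (p i j * p j k * p i k)) := by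
  simp only [energy, triDensity, gFun_eq_binEntropy, expect_add_distrib, expect_sub_distrib,
    ← mul_expect, Fintype.expect_const, ← expect_div]
  ring

/-- If the arithmetic-geometric defect on triples is small and most entries are close to `u₁` or
`u₂`, then entries along paths are close on average. -/
lemma path_le_defect {u₁ u₂ : ℝ} (hu : 0 < u₂ - u₁) {p : Fin n → Fin n → ℝ}
    (hp : ∀ i j, p i j ∈ Set.Icc (0 : ℝ) 1) :
    u₁ * 𝔼 i, 𝔼 j, 𝔼 k, (p i j - p j k) ^ 2 ≤
      2 * (𝔼 i, 𝔼 j, 𝔼 k, (p i j ^ 3 + p j k ^ 3 + p i k ^ 3 - 3 * (p i j * p j k * p i k)))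
        + (𝔼 i, 𝔼 j, |(p i j - u₁) * (p i j - u₂)|) / (u₂ - u₁) := by
  calc u₁ * 𝔼 i, 𝔼 j, 𝔼 k, (p i j - p j k) ^ 2
      = 𝔼 i, 𝔼 j, 𝔼 k, u₁ * (p i j - p j k) ^ 2 := by simp only [mul_expect]
      _ ≤ 𝔼 i, 𝔼 j, 𝔼 k,
          (2 * (p i j ^ 3 + p j k ^ 3 + p i k ^ 3 - 3 * (p i j * p j k * p i k))
            + |(p i j - u₁) * (p i j - u₂)| / (u₂ - u₁)) := expect_mono₃ fun i j k => ?_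
      _ = _ := by
          simp only [expect_add_distrib, ← mul_expect, Fintype.expect_const, expect_div]
  set a := p i j
  set b := p j k
  set c := p i k
  have ha := hp i j
  have hb := hp j k
  have hc := hp i k
  have e1 : 2 * (a ^ 3 + b ^ 3 + c ^ 3 - 3 * (a * b * c))
      = a * (a - b) ^ 2 + (b + c) * (a - b) ^ 2
        + (a + b + c) * ((b - c) ^ 2 + (a - c) ^ 2) := by ring
  have e2 : 0 ≤ (b + c) * (a - b) ^ 2 + (a + b + c) * ((b - c) ^ 2 + (a - c) ^ 2) := by
    have := ha.1; have := hb.1; have := hc.1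
    positivity
  have e3 : (a - b) ^ 2 ≤ 1 := by
    have := ha.1; have := hb.1; have := ha.2; have := hb.2
    nlinarith
  have e4 : u₁ - a ≤ |(a - u₁) * (a - u₂)| / (u₂ - u₁) := by
    rw [le_div_iff₀ hu]
    rcases le_total u₁ a with hle | hle
    · exact (mul_nonpos_of_nonpos_of_nonneg (by linarith) hu.le).trans (abs_nonneg _)
    · refine le_trans ?_ (le_abs_self _)
      nlinarith
  have e5 : 0 ≤ |(a - u₁) * (a - u₂)| / (u₂ - u₁) := by positivity
  nlinarith [mul_le_mul_of_nonneg_right e4 (sq_nonneg (a - b)),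
    mul_le_mul_of_nonneg_left e3 e5]

lemma abs_mean_sub_mul_le (u₁ u₂ : ℝ) (p : Fin n → Fin n → ℝ) :
    |((𝔼 i, 𝔼 j, p i j) - u₁) * ((𝔼 i, 𝔼 j, p i j) - u₂)|
      ≤ (𝔼 i, 𝔼 j, |(p i j - u₁) * (p i j - u₂)|) + 𝔼 i, 𝔼 j, (p i j - 𝔼 i, 𝔼 j, p i j) ^ 2 := by
  have hW0 : 0 ≤ 𝔼 i, 𝔼 j, (p i j - 𝔼 i, 𝔼 j, p i j) ^ 2 :=
    expect_nonneg fun i _ => expect_nonneg fun j _ => sq_nonneg _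
  set m := 𝔼 i, 𝔼 j, p i j with hm
  set W := 𝔼 i, 𝔼 j, (p i j - m) ^ 2 with hW
  set ω := 𝔼 i, 𝔼 j, |(p i j - u₁) * (p i j - u₂)| with hω
  have hvar2 := expect_sq_sub_mean p
  rw [← hm, ← hW] at hvar2
  have e : (m - u₁) * (m - u₂) = (𝔼 i, 𝔼 j, (p i j - u₁) * (p i j - u₂)) - W := by
    have e1 : ∀ i j, (p i j - u₁) * (p i j - u₂) = p i j ^ 2 - (u₁ + u₂) * p i j + u₁ * u₂ :=
      fun i j => by ring
    simp only [e1, expect_add_distrib, expect_sub_distrib, ← mul_expect, Fintype.expect_const,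
      ← hm, hvar2]
    ring
  have e2 : |𝔼 i, 𝔼 j, (p i j - u₁) * (p i j - u₂)| ≤ ω :=
    (abs_expect_le _ _).trans (expect_le_expect fun i _ => abs_expect_le _ _)
  rw [e]
  exact (abs_sub _ _).trans (by rw [abs_of_nonneg hW0]; linarith)

end Expect

/-- A weighted graph whose triangle density stays away from those of the two maximizers has
energy bounded away from the maximum, uniformly in the number of vertices. -/
theorem exists_energy_gap {α h u₁ u₂ : ℝ} (hα : 0 < α)
    (h0 : 0 < u₁) (h12 : u₁ < u₂) (h1 : u₂ < 1)
    (hmax : ∀ u ∈ Set.Icc (0 : ℝ) 1, gFun α h u ≤ gFun α h u₁)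
    (huniq : ∀ u ∈ Set.Icc (0 : ℝ) 1, gFun α h u = gFun α h u₁ → u = u₁ ∨ u = u₂)
    {ε : ℝ} (hε : 0 < ε) :
    ∃ τ > 0, ∀ (n : ℕ) [NeZero n] (p : Fin n → Fin n → ℝ), (∀ i j, p i j ∈ Set.Icc (0 : ℝ) 1) →
      ε ≤ |triDensity p - u₁ ^ 3| → ε ≤ |triDensity p - u₂ ^ 3| →
      energy α h p ≤ gFun α h u₁ - τ := by
  have hu : 0 < u₂ - u₁ := sub_pos.2 h12
  set A₁ : ℝ := 1 + 2 / u₁ / (u₂ - u₁) with hA₁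
  set A₂ : ℝ := 2 / u₁ * (36 / α) with hA₂
  have hA₁pos : 0 < A₁ := by positivity
  have hA₂pos : 0 < A₂ := by positivity
  set κ : ℝ := ε ^ 2 / 144 with hκ
  have hκpos : 0 < κ := by positivity
  obtain ⟨C, hC, hCle⟩ := exists_le_add_mul_deficit h0 h12 h1 hmax huniq
    (η := κ / (4 * A₁)) (by positivity)
  refine ⟨κ / (4 * (A₁ * C + A₂)), by positivity, fun n _ p hp ht₁ ht₂ => ?_⟩
  by_contra! hlt
  set ω := 𝔼 i, 𝔼 j, |(p i j - u₁) * (p i j - u₂)| with hω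
  set V := 𝔼 i, 𝔼 j, 𝔼 k, (p i j - p j k) ^ 2 with hV
  set m := 𝔼 i, 𝔼 j, p i j with hm
  set D := 𝔼 i, 𝔼 j, 𝔼 k,
    (p i j ^ 3 + p j k ^ 3 + p i k ^ 3 - 3 * (p i j * p j k * p i k)) with hD
  set d := gFun α h u₁ - 𝔼 i, 𝔼 j, gFun α h (p i j) with hd
  have hmem : m ∈ Set.Icc (0 : ℝ) 1 :=
    ⟨expect_nonneg fun i _ => expect_nonneg fun j _ => (hp i j).1,
      expect_le univ_nonempty fun i _ => expect_le univ_nonempty fun j _ => (hp i j).2⟩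
  have hd0 : 0 ≤ d := sub_nonneg.2 <|
    expect_le univ_nonempty fun i _ => expect_le univ_nonempty fun j _ => hmax _ (hp i j)
  have hωle : ω ≤ κ / (4 * A₁) + C * d := by
    calc ω ≤ 𝔼 i, 𝔼 j, (κ / (4 * A₁) + C * (gFun α h u₁ - gFun α h (p i j))) :=
          expect_mono₂ fun i j => hCle _ (hp i j)
      _ = _ := by
          simp only [expect_add_distrib, expect_sub_distrib, ← mul_expect, Fintype.expect_const, hd]
  have hVD := path_le_defect hu (u₁ := u₁) hp
  have hD0 := defect_nonneg hp
  rw [← hD] at hVD hD0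
  rw [← hV, ← hω] at hVD
  have hvar := variance_le_of_path p
  rw [← hm, ← hV] at hvar
  have htri := abs_triDensity_sub_cube_le hp hmem (c := ε / 12) (by positivity)
  have hmm := abs_mean_sub_mul_le u₁ u₂ p
  rw [← hm, ← hω] at hmm
  rw [energy_eq α h p, ← hD] at hlt
  have hω0 : 0 ≤ ω := expect_nonneg fun i _ => expect_nonneg fun j _ => abs_nonneg _
  have hW0 : 0 ≤ 𝔼 i, 𝔼 j, (p i j - m) ^ 2 :=
    expect_nonneg fun i _ => expect_nonneg fun j _ => sq_nonneg _
  have hen : d + α / 18 * D < κ / (4 * (A₁ * C + A₂)) := by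
    rw [hd]
    linarith only [hlt]
  generalize 𝔼 i, 𝔼 j, (p i j - m) ^ 2 = W at hvar htri hmm hW0
  generalize triDensity p = t at ht₁ ht₂ htri
  clear_value ω V m D d A₁ A₂ κ
  clear hω hV hm hD hd hp hlt hmax huniq hCle
  have hαD : 0 ≤ α / 18 * D := by positivity
  have hWle : W ≤ 2 / u₁ * (2 * D + ω / (u₂ - u₁)) := by
    have : V ≤ (2 * D + ω / (u₂ - u₁)) / u₁ := by rw [le_div_iff₀ h0]; linarith
    calc W ≤ 2 * V := hvar
      _ ≤ 2 * ((2 * D + ω / (u₂ - u₁)) / u₁) := by linarith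
      _ = _ := by ring
  have hsum : ω + W ≤ A₁ * ω + A₂ * (α / 18 * D) := by
    have : A₁ * ω + A₂ * (α / 18 * D) = ω + 2 / u₁ * (2 * D + ω / (u₂ - u₁)) := by
      rw [hA₁, hA₂]; field_simp; ring
    linarith
  have hsmall : ω + W < κ / 2 := by
    have hs1 : A₁ * ω ≤ κ / 4 + A₁ * C * d := by
      have := mul_le_mul_of_nonneg_left hωle hA₁pos.le
      have e : A₁ * (κ / (4 * A₁) + C * d) = κ / 4 + A₁ * C * d := by field_simp
      linarith
    have hden : 0 < A₁ * C + A₂ := by positivity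
    have hs2 : (A₁ * C + A₂) * (d + α / 18 * D) < κ / 4 := by
      have := mul_lt_mul_of_pos_left hen hden
      have e : (A₁ * C + A₂) * (κ / (4 * (A₁ * C + A₂))) = κ / 4 := by field_simp
      linarith
    have hs3 : 0 ≤ A₁ * C * (α / 18 * D) := by positivity
    have hs4 : 0 ≤ A₂ * d := by positivity
    nlinarith
  have htri' : |t - m ^ 3| < ε / 2 := by
    have : (ε / 12)⁻¹ * W < ε / 12 := by
      rw [inv_mul_eq_div, div_lt_iff₀ (by positivity)]
      nlinarith
    linarith
  have hfar : ∀ u ∈ Set.Icc (0 : ℝ) 1, ε ≤ |t - u ^ 3| → ε / 6 ≤ |m - u| := by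
    intro u hu hfar
    have e1 : |m ^ 3 - u ^ 3| ≤ 3 * |m - u| := by
      have : m ^ 3 - u ^ 3 = (m - u) * (m ^ 2 + m * u + u ^ 2) := by ring
      have h2 := hmem.1; have h3 := hmem.2; have h4 := hu.1; have h5 := hu.2
      rw [this, abs_mul, abs_of_nonneg (show 0 ≤ m ^ 2 + m * u + u ^ 2 by positivity), mul_comm]
      exact mul_le_mul_of_nonneg_right (by nlinarith) (abs_nonneg _)
    have e2 : |t - u ^ 3| ≤ |t - m ^ 3| + |m ^ 3 - u ^ 3| :=
      abs_sub_le _ _ _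
    linarith
  have f1 := hfar u₁ ⟨h0.le, by linarith⟩ ht₁
  have f2 := hfar u₂ ⟨by linarith, h1.le⟩ ht₂
  have f3 : ε / 6 * (ε / 6) ≤ |(m - u₁) * (m - u₂)| := by
    rw [abs_mul]; gcongr
  nlinarith

/-! ### Cut norm and triangle densities -/

/-- Real-valued adjacency matrix. -/
noncomputable def adj {n : ℕ} (G : SimpleGraph (Fin n)) (i j : Fin n) : ℝ :=
  if G.Adj i j then 1 else 0

lemma adj_mem_Icc {n : ℕ} (G : SimpleGraph (Fin n)) (i j : Fin n) :
    adj G i j ∈ Set.Icc (0 : ℝ) 1 := by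
  unfold adj
  split_ifs <;> simp

/-- A linear functional on the cube is bounded by its values at the vertices. -/
lemma abs_sum_mul_le_of_forall_finset {ι : Type*} [Fintype ι] {b u : ι → ℝ} {c : ℝ}
    (hb : ∀ S : Finset ι, |∑ i ∈ S, b i| ≤ c) (hu : ∀ i, u i ∈ Set.Icc (0 : ℝ) 1) :
    |∑ i, u i * b i| ≤ c := by
  have key : ∀ b : ι → ℝ, (∀ S : Finset ι, |∑ i ∈ S, b i| ≤ c) → ∑ i, u i * b i ≤ c := by
    intro b hb
    calc ∑ i, u i * b i ≤ ∑ i, if 0 ≤ b i then b i else 0 := sum_le_sum fun i _ => by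
          split_ifs with h
          · exact mul_le_of_le_one_left h (hu i).2
          · exact mul_nonpos_of_nonneg_of_nonpos (hu i).1 (not_le.1 h).le
      _ = ∑ i with 0 ≤ b i, b i := (sum_filter _ _).symm
      _ ≤ c := (le_abs_self _).trans (hb _)
  refine abs_le'.2 ⟨key b hb, ?_⟩
  have := key (fun i => -b i) fun S => by simpa using hb S
  simpa using this

/-- A bilinear form on the cube is bounded by its values at the vertices. -/
lemma abs_bilin_le_of_forall_finset {ι : Type*} [Fintype ι] {B : ι → ι → ℝ} {c : ℝ}
    (hB : ∀ S T : Finset ι, |∑ i ∈ S, ∑ j ∈ T, B i j| ≤ c) {u v : ι → ℝ}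
    (hu : ∀ i, u i ∈ Set.Icc (0 : ℝ) 1) (hv : ∀ i, v i ∈ Set.Icc (0 : ℝ) 1) :
    |∑ i, ∑ j, u i * v j * B i j| ≤ c := by
  have h1 : ∀ S : Finset ι, |∑ i ∈ S, ∑ j, v j * B i j| ≤ c := fun S => by
    have := abs_sum_mul_le_of_forall_finset (b := fun j => ∑ i ∈ S, B i j) (u := v) (c := c)
      (fun T => by rw [sum_comm]; exact hB S T) hv
    simp only [mul_sum] at this
    rwa [sum_comm]
  have := abs_sum_mul_le_of_forall_finset h1 hu
  simpa only [mul_sum, mul_assoc] using this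

/-- Counting lemma for triangles: the triangle density is Lipschitz in the cut norm. -/
lemma abs_triDensity_sub_le {n : ℕ} [NeZero n] {a p : Fin n → Fin n → ℝ}
    (ha : ∀ i j, a i j ∈ Set.Icc (0 : ℝ) 1) (hp : ∀ i j, p i j ∈ Set.Icc (0 : ℝ) 1) {δ : ℝ}
    (hcut : ∀ S T : Finset (Fin n), |∑ i ∈ S, ∑ j ∈ T, (a i j - p i j)| ≤ δ * (n : ℝ) ^ 2) :
    |triDensity a - triDensity p| ≤ 3 * δ := by
  have hn : (0 : ℝ) < n := Nat.cast_pos.2 (NeZero.pos n)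
  have hbil : ∀ u v : Fin n → ℝ, (∀ i, u i ∈ Set.Icc (0 : ℝ) 1) → (∀ i, v i ∈ Set.Icc (0 : ℝ) 1) →
      |𝔼 i, 𝔼 j, u i * v j * (a i j - p i j)| ≤ δ := fun u v hu hv => by
    have := abs_bilin_le_of_forall_finset hcut hu hv
    simp only [Fintype.expect_eq_sum_div_card, Fintype.card_fin, ← sum_div]
    rw [div_div, abs_div, abs_of_pos (mul_pos hn hn), div_le_iff₀ (mul_pos hn hn), ← sq]
    exact this
  have hE : ∀ F : Fin n → ℝ, (∀ i, |F i| ≤ δ) → |𝔼 i, F i| ≤ δ := fun F hF =>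
    (abs_expect_le _ _).trans (expect_le univ_nonempty fun i _ => hF i)
  have h1 : |𝔼 k, 𝔼 i, 𝔼 j, a i k * a j k * (a i j - p i j)| ≤ δ :=
    hE _ fun k => hbil _ _ (fun i => ha i k) (fun j => ha j k)
  have h2 : |𝔼 i, 𝔼 j, 𝔼 k, p i j * a i k * (a j k - p j k)| ≤ δ :=
    hE _ fun i => hbil _ _ (fun j => hp i j) (fun k => ha i k)
  have h3 : |𝔼 j, 𝔼 i, 𝔼 k, p i j * p j k * (a i k - p i k)| ≤ δ :=
    hE _ fun j => hbil _ _ (fun i => hp i j) (fun k => hp j k)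
  have hsplit : triDensity a - triDensity p
      = (𝔼 k, 𝔼 i, 𝔼 j, a i k * a j k * (a i j - p i j))
        + (𝔼 i, 𝔼 j, 𝔼 k, p i j * a i k * (a j k - p j k))
        + 𝔼 j, 𝔼 i, 𝔼 k, p i j * p j k * (a i k - p i k) := by
    have e1 : 𝔼 k, 𝔼 i, 𝔼 j, a i k * a j k * (a i j - p i j)
        = 𝔼 i, 𝔼 j, 𝔼 k, a i k * a j k * (a i j - p i j) := by
      rw [expect_comm]
      exact expect_congr rfl fun i _ => expect_comm _ _ _
    have e2 : 𝔼 j, 𝔼 i, 𝔼 k, p i j * p j k * (a i k - p i k)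
        = 𝔼 i, 𝔼 j, 𝔼 k, p i j * p j k * (a i k - p i k) := expect_comm _ _ _
    rw [e1, e2]
    simp only [triDensity, ← expect_add_distrib, ← expect_sub_distrib]
    refine expect_congr rfl fun i _ => expect_congr rfl fun j _ => expect_congr rfl fun k _ => ?_
    ring
  rw [hsplit]
  exact (abs_add_three _ _ _).trans (by linarith)

/-! ### Block averages along regular partitions -/

/-- The vertices with label `a`. -/
def labelClass {n K : ℕ} (f : Fin n → Fin K) (a : Fin K) : Finset (Fin n) := {i | f i = a}

/-- The weighted graph obtained by averaging `G` over pairs of label classes. -/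
noncomputable def blockAvg {n K : ℕ} (G : SimpleGraph (Fin n)) (f : Fin n → Fin K)
    (i j : Fin n) : ℝ :=
  (G.edgeDensity (labelClass f (f i)) (labelClass f (f j)) : ℝ)

lemma blockAvg_mem_Icc {n K : ℕ} (G : SimpleGraph (Fin n)) (f : Fin n → Fin K) (i j : Fin n) :
    blockAvg G f i j ∈ Set.Icc (0 : ℝ) 1 :=
  ⟨Rat.cast_nonneg.2 (G.edgeDensity_nonneg _ _), by
    rw [blockAvg]
    exact_mod_cast G.edgeDensity_le_one _ _⟩

lemma blockAvg_comm {n K : ℕ} (G : SimpleGraph (Fin n)) (f : Fin n → Fin K) (i j : Fin n) :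
    blockAvg G f i j = blockAvg G f j i := by
  rw [blockAvg, blockAvg, G.edgeDensity_comm]

lemma sum_adj_eq_card_interedges {n : ℕ} (G : SimpleGraph (Fin n)) (S T : Finset (Fin n)) :
    ∑ i ∈ S, ∑ j ∈ T, adj G i j = #(G.interedges S T) := by
  simp only [adj]
  rw [← sum_product', sum_boole, SimpleGraph.interedges, Rel.interedges]

lemma sum_adj_eq_edgeDensity_mul {n : ℕ} (G : SimpleGraph (Fin n)) (S T : Finset (Fin n)) :
    ∑ i ∈ S, ∑ j ∈ T, adj G i j = (G.edgeDensity S T : ℝ) * (#S * #T) := by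
  rw [sum_adj_eq_card_interedges, SimpleGraph.edgeDensity_def]
  rcases S.eq_empty_or_nonempty with rfl | hS
  · simp
  rcases T.eq_empty_or_nonempty with rfl | hT
  · simp [SimpleGraph.interedges, Rel.interedges]
  have : (0 : ℝ) < #S * #T := by
    have := hS.card_pos; have := hT.card_pos; positivity
  push_cast
  field_simp

/-- Averaging preserves sums weighted by functions of the labels. -/
lemma sum_adj_mul_label {n K : ℕ} (G : SimpleGraph (Fin n)) (f : Fin n → Fin K)
    (φ : Fin K → Fin K → ℝ) :
    ∑ i, ∑ j, adj G i j * φ (f i) (f j) = ∑ i, ∑ j, blockAvg G f i j * φ (f i) (f j) := by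
  have hsplit : ∀ F : Fin n → Fin n → ℝ, ∑ i, ∑ j, F i j
      = ∑ a, ∑ b, ∑ i ∈ labelClass f a, ∑ j ∈ labelClass f b, F i j := fun F => by
    rw [← sum_fiberwise univ f]
    refine sum_congr rfl fun a _ => ?_
    rw [sum_comm (s := univ)]
    exact sum_congr rfl fun i _ => (sum_fiberwise univ f (F i)).symm
  rw [hsplit, hsplit]
  refine sum_congr rfl fun a _ => sum_congr rfl fun b _ => ?_
  have h1 : ∑ i ∈ labelClass f a, ∑ j ∈ labelClass f b, adj G i j * φ (f i) (f j)
      = (∑ i ∈ labelClass f a, ∑ j ∈ labelClass f b, adj G i j) * φ a b := by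
    simp only [sum_mul]
    refine sum_congr rfl fun i hi => sum_congr rfl fun j hj => ?_
    simp only [labelClass, mem_filter, mem_univ, true_and] at hi hj
    rw [hi, hj]
  have h2 : ∑ i ∈ labelClass f a, ∑ j ∈ labelClass f b, blockAvg G f i j * φ (f i) (f j)
      = ∑ i ∈ labelClass f a, ∑ j ∈ labelClass f b,
        (G.edgeDensity (labelClass f a) (labelClass f b) : ℝ) * φ a b := by
    refine sum_congr rfl fun i hi => sum_congr rfl fun j hj => ?_
    simp only [labelClass, mem_filter, mem_univ, true_and] at hi hj
    rw [blockAvg, hi, hj]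
  rw [h1, h2, sum_adj_eq_edgeDensity_mul]
  simp only [sum_const, nsmul_eq_mul]
  ring

lemma abs_edgeDensity_sub_mul_le {n : ℕ} (G : SimpleGraph (Fin n)) (S T U V : Finset (Fin n)) :
    |((G.edgeDensity S T : ℝ) - G.edgeDensity U V) * (#S * #T)| ≤ #S * #T := by
  have h0 : (0 : ℝ) ≤ #S * #T := by positivity
  have h1 : |(G.edgeDensity S T : ℝ) - G.edgeDensity U V| ≤ 1 := by
    have h2 : (0 : ℝ) ≤ G.edgeDensity S T := by exact_mod_cast G.edgeDensity_nonneg _ _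
    have h3 : (G.edgeDensity S T : ℝ) ≤ 1 := by exact_mod_cast G.edgeDensity_le_one _ _
    have h4 : (0 : ℝ) ≤ G.edgeDensity U V := by exact_mod_cast G.edgeDensity_nonneg _ _
    have h5 : (G.edgeDensity U V : ℝ) ≤ 1 := by exact_mod_cast G.edgeDensity_le_one _ _
    exact abs_le.2 ⟨by linarith, by linarith⟩
  rw [abs_mul, abs_of_nonneg h0]
  exact mul_le_of_le_one_left h0 h1

/-- Boxes inside a uniform pair have roughly the expected number of edges. -/
lemma abs_edgeDensity_sub_mul_le_of_isUniform {n : ℕ} (G : SimpleGraph (Fin n)) {ε : ℝ}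
    (hε : 0 < ε) {S T U V : Finset (Fin n)} (hS : S ⊆ U) (hT : T ⊆ V) (h : G.IsUniform ε U V) :
    |((G.edgeDensity S T : ℝ) - G.edgeDensity U V) * (#S * #T)| ≤ ε * (#U * #V) := by
  have hU : (#S : ℝ) ≤ #U := by exact_mod_cast card_le_card hS
  have hV : (#T : ℝ) ≤ #V := by exact_mod_cast card_le_card hT
  have h0 : (0 : ℝ) ≤ #S * #T := by positivity
  by_cases hSU : (#U : ℝ) * ε ≤ #S
  · by_cases hTV : (#V : ℝ) * ε ≤ #T
    · have := h hS hT hSU hTV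
      rw [abs_mul, abs_of_nonneg h0]
      gcongr
    · calc _ ≤ (#S : ℝ) * #T := abs_edgeDensity_sub_mul_le G S T U V
        _ ≤ #U * (#V * ε) := by gcongr; exact (not_le.1 hTV).le
        _ = _ := by ring
  · calc _ ≤ (#S : ℝ) * #T := abs_edgeDensity_sub_mul_le G S T U V
      _ ≤ (#U * ε) * #V := by gcongr; exact (not_le.1 hSU).le
      _ = _ := by ring

/-- Cut-norm estimate for a uniform equipartition. -/
lemma abs_cut_le_of_isUniform {n : ℕ} [NeZero n] (G : SimpleGraph (Fin n)) {ε : ℝ} (hε : 0 < ε)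
    (P : Finpartition (univ : Finset (Fin n))) (hP : P.IsEquipartition)
    (hunif : P.IsUniform G ε) (hcard : 1 / ε ≤ #P.parts) (S T : Finset (Fin n)) :
    |∑ i ∈ S, ∑ j ∈ T, (adj G i j - (G.edgeDensity (P.part i) (P.part j) : ℝ))|
      ≤ 9 * ε * (n : ℝ) ^ 2 := by
  set k : ℕ := #P.parts with hk
  have hkpos : (0 : ℝ) < k := (one_div_pos.2 hε).trans_le hcard
  have hkn : (k : ℝ) ≤ n := by
    have := P.card_parts_le_card
    rw [card_univ, Fintype.card_fin] at this
    exact_mod_cast this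
  have hsize : ∀ U ∈ P.parts, (#U : ℝ) ≤ 2 * (n / k) := fun U hU => by
    have h1 := hP.card_part_le_average_add_one hU
    rw [card_univ, Fintype.card_fin, ← hk] at h1
    have h2 : (#U : ℝ) ≤ (n / k : ℕ) + 1 := by exact_mod_cast h1
    have h3 : ((n / k : ℕ) : ℝ) ≤ n / k := Nat.cast_div_le
    have h4 : 1 ≤ (n : ℝ) / k := (one_le_div hkpos).2 hkn
    linarith
  have hmaps : ∀ A : Finset (Fin n), ∀ i ∈ A, P.part i ∈ P.parts := fun A i _ =>
    P.part_mem.2 (mem_univ i)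
  have hsub : ∀ (A U : Finset (Fin n)), A.filter (fun i => P.part i = U) ⊆ U := fun A U i hi => by
    rw [mem_filter] at hi
    rw [← hi.2]
    exact P.mem_part (mem_univ i)
  set X : Finset (Fin n) × Finset (Fin n) → ℝ := fun q =>
    ((G.edgeDensity (S.filter (fun i => P.part i = q.1)) (T.filter (fun i => P.part i = q.2)) : ℝ)
      - G.edgeDensity q.1 q.2)
      * (#(S.filter (fun i => P.part i = q.1)) * #(T.filter (fun i => P.part i = q.2))) with hX
  have hsplit : ∑ i ∈ S, ∑ j ∈ T, (adj G i j - (G.edgeDensity (P.part i) (P.part j) : ℝ))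
      = ∑ q ∈ P.parts ×ˢ P.parts, X q := by
    rw [sum_product, ← sum_fiberwise_of_maps_to (hmaps S)]
    refine sum_congr rfl fun U _ => ?_
    rw [sum_comm, ← sum_fiberwise_of_maps_to (hmaps T)]
    refine sum_congr rfl fun V _ => ?_
    rw [sum_comm, hX]
    simp only [sub_mul]
    rw [← sum_adj_eq_edgeDensity_mul]
    simp only [sum_sub_distrib]
    congr 1
    have : ∀ i ∈ S.filter (fun i => P.part i = U), ∑ j ∈ T.filter (fun i => P.part i = V),
        (G.edgeDensity (P.part i) (P.part j) : ℝ)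
        = #(T.filter (fun i => P.part i = V)) * (G.edgeDensity U V : ℝ) := fun i hi => by
      rw [← nsmul_eq_mul, ← sum_const]
      refine sum_congr rfl fun j hj => ?_
      rw [(mem_filter.1 hi).2, (mem_filter.1 hj).2]
    rw [sum_congr rfl this, sum_const, nsmul_eq_mul]
    ring
  have hbound : ∀ q ∈ P.parts ×ˢ P.parts, |X q| ≤ ε * (#q.1 * #q.2)
      + (if q ∈ P.nonUniforms G ε then (2 * (n / k)) ^ 2 else 0 : ℝ)
      + (if q.1 = q.2 then (2 * (n / k)) ^ 2 else 0 : ℝ) := by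
    rintro ⟨U, V⟩ hq
    obtain ⟨hU, hV⟩ := mem_product.1 hq
    have hε0 : 0 ≤ ε * ((#U : ℝ) * #V) := by positivity
    have hcrude : |X (U, V)| ≤ (2 * (n / k)) ^ 2 := by
      refine (abs_edgeDensity_sub_mul_le G _ _ _ _).trans ?_
      rw [sq]
      have h1 : (#(S.filter (fun i => P.part i = U)) : ℝ) ≤ #U := by
        exact_mod_cast card_le_card (hsub S U)
      have h2 : (#(T.filter (fun i => P.part i = V)) : ℝ) ≤ #V := by
        exact_mod_cast card_le_card (hsub T V)
      have h3 := hsize U hU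
      have h4 := hsize V hV
      exact mul_le_mul (h1.trans h3) (h2.trans h4) (by positivity) (by positivity)
    have hsq : (0 : ℝ) ≤ (2 * (n / k)) ^ 2 := sq_nonneg _
    by_cases hd : U = V
    · simp only [hd, if_true]
      rw [hd] at hcrude hε0
      split_ifs <;> linarith
    · simp only [hd, if_false, add_zero]
      by_cases hnu : (U, V) ∈ P.nonUniforms G ε
      · simp only [hnu, if_true]
        linarith
      · simp only [hnu, if_false, add_zero]
        refine abs_edgeDensity_sub_mul_le_of_isUniform G hε (hsub S U) (hsub T V) ?_
        by_contra hcon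
        exact hnu ((Finpartition.mk_mem_nonUniforms P G).2 ⟨hU, hV, hd, hcon⟩)
  have hsum1 : ∑ q ∈ P.parts ×ˢ P.parts, ε * ((#q.1 : ℝ) * #q.2) = ε * (n : ℝ) ^ 2 := by
    rw [← mul_sum, sum_product]
    simp only
    rw [← sum_mul_sum, ← Nat.cast_sum, P.sum_card_parts, card_univ,
      Fintype.card_fin, sq]
  have hk2 : (k : ℝ) ^ 2 * ε * (2 * (n / k)) ^ 2 = 4 * ε * (n : ℝ) ^ 2 := by
    field_simp
    ring
  have hsum2 : ∑ q ∈ P.parts ×ˢ P.parts,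
      (if q ∈ P.nonUniforms G ε then (2 * (n / k)) ^ 2 else 0 : ℝ) ≤ 4 * ε * (n : ℝ) ^ 2 := by
    rw [← sum_filter, sum_const, nsmul_eq_mul, ← hk2]
    refine mul_le_mul_of_nonneg_right ?_ (sq_nonneg _)
    have h1 : #((P.parts ×ˢ P.parts).filter (fun q => q ∈ P.nonUniforms G ε))
        ≤ #(P.nonUniforms G ε) := card_le_card fun q hq => (mem_filter.1 hq).2
    have h2 : (#(P.nonUniforms G ε) : ℝ) ≤ (k * (k - 1) : ℕ) * ε := hunif
    have h3 : ((k * (k - 1) : ℕ) : ℝ) ≤ (k : ℝ) ^ 2 := by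
      rw [sq]
      exact_mod_cast Nat.mul_le_mul_left k (Nat.sub_le k 1)
    calc _ ≤ (#(P.nonUniforms G ε) : ℝ) := by exact_mod_cast h1
      _ ≤ _ := h2
      _ ≤ _ := by gcongr
  have hsum3 : ∑ q ∈ P.parts ×ˢ P.parts,
      (if q.1 = q.2 then (2 * (n / k)) ^ 2 else 0 : ℝ) ≤ 4 * ε * (n : ℝ) ^ 2 := by
    have : ∑ q ∈ P.parts ×ˢ P.parts, (if q.1 = q.2 then (2 * (n / k)) ^ 2 else 0 : ℝ)
        = k * (2 * (n / k)) ^ 2 := by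
      rw [sum_product]
      simp only [sum_ite_eq]
      rw [← sum_filter, filter_true_of_mem fun _ h => h, sum_const, nsmul_eq_mul]
    rw [this, ← hk2]
    refine mul_le_mul_of_nonneg_right ?_ (sq_nonneg _)
    have : 1 ≤ k * ε := by rwa [div_le_iff₀ hε] at hcard
    nlinarith
  calc _ = |∑ q ∈ P.parts ×ˢ P.parts, X q| := by rw [hsplit]
    _ ≤ ∑ q ∈ P.parts ×ˢ P.parts, |X q| := abs_sum_le_sum_abs _ _
    _ ≤ _ := sum_le_sum hbound
    _ ≤ ε * (n : ℝ) ^ 2 + 4 * ε * (n : ℝ) ^ 2 + 4 * ε * (n : ℝ) ^ 2 := by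
        rw [sum_add_distrib, sum_add_distrib, hsum1]
        gcongr
    _ = _ := by ring

/-- Every large graph is close in cut norm to a block average with boundedly many blocks. -/
theorem exists_label_cut_le {δ : ℝ} (hδ : 0 < δ) :
    ∃ K N : ℕ, ∀ n, N ≤ n → ∀ [NeZero n] (G : SimpleGraph (Fin n)), ∃ f : Fin n → Fin K,
      ∀ S T : Finset (Fin n),
        |∑ i ∈ S, ∑ j ∈ T, (adj G i j - blockAvg G f i j)| ≤ δ * (n : ℝ) ^ 2 := by
  set ε : ℝ := δ / 9 with hε
  have hεpos : 0 < ε := by positivity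
  set l : ℕ := ⌈1 / ε⌉₊ with hl
  refine ⟨SzemerediRegularity.bound ε l, l, fun n hn _ G => ?_⟩
  obtain ⟨P, hP, hlP, hPb, hunif⟩ := szemeredi_regularity G hεpos (l := l) (by simpa using hn)
  set f : Fin n → Fin (SzemerediRegularity.bound ε l) := fun i =>
    Fin.castLE hPb (P.parts.equivFin ⟨P.part i, P.part_mem.2 (mem_univ i)⟩) with hf
  have hclass : ∀ i, labelClass f (f i) = P.part i := fun i => by
    ext j
    simp only [labelClass, hf, mem_filter, mem_univ, true_and, Fin.castLE_inj,
      EmbeddingLike.apply_eq_iff_eq, Subtype.mk.injEq]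
    constructor
    · intro h
      rw [← h]
      exact P.mem_part (mem_univ j)
    · exact fun h => P.part_eq_of_mem (P.part_mem.2 (mem_univ i)) h
  refine ⟨f, fun S T => ?_⟩
  have := abs_cut_le_of_isUniform G hεpos P hP hunif
    ((Nat.le_ceil _).trans (by exact_mod_cast hlP)) S T
  simp only [blockAvg, hclass]
  rw [show δ = 9 * ε by rw [hε]; ring]
  exact this

/-! ### Inhomogeneous Bernoulli weights on graphs -/

/-- The edge set of `G` as a finite set. -/
noncomputable def edges {n : ℕ} (G : SimpleGraph (Fin n)) : Finset (Sym2 (Fin n)) :=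
  {e | e ∈ G.edgeSet}

lemma mem_edges {n : ℕ} {G : SimpleGraph (Fin n)} {e : Sym2 (Fin n)} :
    e ∈ edges G ↔ e ∈ G.edgeSet := by
  simp [edges]

lemma edges_subset_top {n : ℕ} (G : SimpleGraph (Fin n)) : edges G ⊆ edges ⊤ := fun _ he =>
  mem_edges.2 (SimpleGraph.edgeSet_mono le_top (mem_edges.1 he))

lemma edgeCount_eq {n : ℕ} (G : SimpleGraph (Fin n)) : edgeCount G = #(edges G) := by
  rw [edgeCount, edges, Nat.card_eq_fintype_card, Fintype.card_subtype]

/-- Weight of `G` when each edge `e` is present independently with probability `q e`. -/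
noncomputable def bernWeight {n : ℕ} (q : Sym2 (Fin n) → ℝ) (G : SimpleGraph (Fin n)) : ℝ :=
  ∏ e ∈ edges ⊤, if e ∈ edges G then q e else 1 - q e

lemma bernWeight_nonneg {n : ℕ} {q : Sym2 (Fin n) → ℝ} (hq : ∀ e, q e ∈ Set.Icc (0 : ℝ) 1)
    (G : SimpleGraph (Fin n)) : 0 ≤ bernWeight q G :=
  prod_nonneg fun e _ => by
    split_ifs
    · exact (hq e).1
    · exact sub_nonneg.2 (hq e).2

lemma sum_graph_eq_sum_powerset {n : ℕ} (F : Finset (Sym2 (Fin n)) → ℝ) :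
    ∑ G : SimpleGraph (Fin n), F (edges G)
      = ∑ t ∈ (edges (⊤ : SimpleGraph (Fin n))).powerset, F t := by
  refine sum_nbij edges (fun G _ => mem_powerset.2 (edges_subset_top G)) ?_ ?_ fun _ _ => rfl
  · intro G _ H _ h
    refine SimpleGraph.edgeSet_injective (Set.ext fun e => ?_)
    rw [← mem_edges, ← mem_edges, h]
  · intro t ht
    refine ⟨SimpleGraph.fromEdgeSet (t : Set (Sym2 (Fin n))), mem_coe.2 (mem_univ _), ?_⟩
    ext e
    rw [mem_edges, SimpleGraph.edgeSet_fromEdgeSet]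
    refine ⟨fun h => h.1, fun h => ⟨h, fun hd => ?_⟩⟩
    exact SimpleGraph.not_isDiag_of_mem_edgeSet _ (mem_edges.1 (mem_powerset.1 ht h)) hd

/-- Under the Bernoulli weights, the probability of containing `F` is a product. -/
lemma sum_bernWeight_of_subset {n : ℕ} (q : Sym2 (Fin n) → ℝ) {F : Finset (Sym2 (Fin n))}
    (hF : F ⊆ edges ⊤) :
    ∑ G : SimpleGraph (Fin n), (if F ⊆ edges G then bernWeight q G else 0) = ∏ e ∈ F, q e := by
  have h1 : ∀ t ∈ (edges (⊤ : SimpleGraph (Fin n))).powerset,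
      (if F ⊆ t then ∏ e ∈ edges ⊤, (if e ∈ t then q e else 1 - q e) else 0)
      = (∏ e ∈ t, q e) * ∏ e ∈ edges ⊤ \ t, (if e ∈ F then 0 else 1 - q e) := by
    intro t ht
    have hts := mem_powerset.1 ht
    split_ifs with h
    · rw [prod_ite, filter_mem_eq_inter, inter_eq_right.2 hts, filter_not, filter_mem_eq_inter,
        inter_eq_right.2 hts]
      congr 1
      refine prod_congr rfl fun e he => ?_
      rw [if_neg fun heF => (mem_sdiff.1 he).2 (h heF)]
    · obtain ⟨e, heF, het⟩ := not_subset.1 h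
      refine (mul_eq_zero_of_right _ ?_).symm
      exact prod_eq_zero (mem_sdiff.2 ⟨hF heF, het⟩) (if_pos heF)
  have h2 := sum_graph_eq_sum_powerset fun t : Finset (Sym2 (Fin n)) =>
    if F ⊆ t then ∏ e ∈ edges ⊤, (if e ∈ t then q e else 1 - q e) else 0
  simp only [bernWeight]
  rw [h2, sum_congr rfl h1, ← prod_add]
  rw [← prod_subset hF (f := fun e => q e + if e ∈ F then 0 else 1 - q e)]
  · exact prod_congr rfl fun e he => by rw [if_pos he, add_zero]
  · intro e _ he
    rw [if_neg he]
    ring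

lemma sum_bernWeight {n : ℕ} (q : Sym2 (Fin n) → ℝ) :
    ∑ G : SimpleGraph (Fin n), bernWeight q G = 1 := by
  simpa using sum_bernWeight_of_subset q (empty_subset (edges ⊤))

/-- Summing over ordered pairs counts every edge twice. -/
lemma two_mul_sum_edges_top {n : ℕ} (F : Sym2 (Fin n) → ℝ) :
    2 * ∑ e ∈ edges ⊤, F e = ∑ i, ∑ j, if i ≠ j then F s(i, j) else 0 := by
  have hmaps : ∀ x ∈ (univ : Finset (Fin n)).offDiag,
      s(x.1, x.2) ∈ edges (⊤ : SimpleGraph (Fin n)) :=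
    fun x hx => by simpa [mem_edges] using hx
  have hfib : ∀ e ∈ edges (⊤ : SimpleGraph (Fin n)),
      #((univ : Finset (Fin n)).offDiag.filter fun x => s(x.1, x.2) = e) = 2 := by
    intro e he
    induction e with | h a b =>
    have hab : a ≠ b := by simpa [mem_edges] using he
    have : ((univ : Finset (Fin n)).offDiag.filter fun x => s(x.1, x.2) = s(a, b))
        = {(a, b), (b, a)} := by
      ext ⟨i, j⟩
      simp only [mem_filter, mem_offDiag, mem_univ, true_and, Sym2.eq_iff, mem_insert,
        mem_singleton, Prod.mk.injEq]
      constructor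
      · exact fun h => h.2
      · rintro (⟨rfl, rfl⟩ | ⟨rfl, rfl⟩)
        · exact ⟨hab, Or.inl ⟨rfl, rfl⟩⟩
        · exact ⟨hab.symm, Or.inr ⟨rfl, rfl⟩⟩
    rw [this, card_pair]
    simp [hab]
  calc 2 * ∑ e ∈ edges ⊤, F e
      = ∑ e ∈ edges ⊤, ∑ x ∈ (univ : Finset (Fin n)).offDiag.filter fun x => s(x.1, x.2) = e,
          F s(x.1, x.2) := by
        rw [mul_sum]
        refine sum_congr rfl fun e he => ?_
        rw [sum_congr rfl fun x hx => by rw [(mem_filter.1 hx).2], sum_const, hfib e he]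
        simp
    _ = ∑ x ∈ (univ : Finset (Fin n)).offDiag, F s(x.1, x.2) := sum_fiberwise_of_maps_to hmaps _
    _ = ∑ x ∈ univ ×ˢ univ, if x.1 ≠ x.2 then F s(x.1, x.2) else 0 := by
        rw [← sum_filter]
        exact sum_congr (by ext ⟨i, j⟩; simp) fun _ _ => rfl
    _ = _ := sum_product _ _ _

lemma two_mul_card_edges_top (n : ℕ) :
    2 * (#(edges (⊤ : SimpleGraph (Fin n))) : ℝ) = n * (n - 1) := by
  have := two_mul_sum_edges_top (n := n) fun _ => 1
  rw [sum_const, nsmul_eq_mul, mul_one] at this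
  rw [this]
  have h : ∀ i : Fin n, ∑ j, (if i ≠ j then (1 : ℝ) else 0) = n - 1 := fun i => by
    have : ∀ j, (if i ≠ j then (1 : ℝ) else 0) = 1 - if i = j then 1 else 0 := fun j => by
      by_cases h : i = j <;> simp [h]
    simp only [this, sum_sub_distrib, sum_ite_eq, mem_univ, if_true]
    simp
  simp only [h]
  simp [mul_sub]

lemma two_mul_edgeCount {n : ℕ} (G : SimpleGraph (Fin n)) :
    2 * (edgeCount G : ℝ) = ∑ i, ∑ j, adj G i j := by
  have := two_mul_sum_edges_top (n := n) fun e => if e ∈ edges G then 1 else 0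
  rw [← sum_filter, filter_mem_eq_inter, inter_eq_right.2 (edges_subset_top G), sum_const,
    nsmul_eq_mul, mul_one] at this
  rw [edgeCount_eq, this]
  refine sum_congr rfl fun i _ => sum_congr rfl fun j _ => ?_
  simp only [mem_edges, SimpleGraph.mem_edgeSet, adj]
  by_cases h : G.Adj i j
  · simp [h, h.ne]
  · simp [h]

/-- The function on unordered pairs induced by a symmetric matrix. -/
noncomputable def symFun {n : ℕ} (p : Fin n → Fin n → ℝ) : Sym2 (Fin n) → ℝ :=
  Sym2.lift ⟨fun i j => (p i j + p j i) / 2, fun i j => by ring⟩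

lemma symFun_mk {n : ℕ} {p : Fin n → Fin n → ℝ} (hp : ∀ i j, p i j = p j i) (i j : Fin n) :
    symFun p s(i, j) = p i j := by
  simp [symFun, hp j i]

/-- The Bernoulli weight of a graph under its own block averages is at least the exponential of
minus the entropy. -/
lemma exp_neg_entropy_le_bernWeight {n K : ℕ} (G : SimpleGraph (Fin n)) (f : Fin n → Fin K) :
    Real.exp (-(∑ i, ∑ j, Real.binEntropy (blockAvg G f i j)) / 2)
      ≤ bernWeight (symFun (blockAvg G f)) G := by
  set p := blockAvg G f with hp
  have hpI : ∀ i j, p i j ∈ Set.Icc (0 : ℝ) 1 := blockAvg_mem_Icc G f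
  have hsymm : ∀ i j, symFun p s(i, j) = p i j := symFun_mk (blockAvg_comm G f)
  have hmem : ∀ i, i ∈ labelClass f (f i) := fun i => by simp [labelClass]
  have hsum : ∀ i j, p i j * (#(labelClass f (f i)) * #(labelClass f (f j)))
      = ∑ a ∈ labelClass f (f i), ∑ b ∈ labelClass f (f j), adj G a b := fun i j =>
    (sum_adj_eq_edgeDensity_mul G _ _).symm
  have hcardpos : ∀ i j, (0 : ℝ) < #(labelClass f (f i)) * #(labelClass f (f j)) := fun i j => by
    have := card_pos.2 ⟨i, hmem i⟩
    have := card_pos.2 ⟨j, hmem j⟩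
    positivity
  have hpos : ∀ i j, G.Adj i j → 0 < p i j := fun i j hij => by
    refine pos_of_mul_pos_left ?_ (hcardpos i j).le
    rw [hsum]
    refine sum_pos' (fun a _ => sum_nonneg fun b _ => (adj_mem_Icc G a b).1) ⟨i, hmem i, ?_⟩
    exact sum_pos' (fun b _ => (adj_mem_Icc G i b).1) ⟨j, hmem j, by simp [adj, hij]⟩
  have hlt : ∀ i j, ¬ G.Adj i j → p i j < 1 := fun i j hij => by
    refine lt_of_mul_lt_mul_right ?_ (hcardpos i j).le
    rw [hsum, one_mul]
    calc _ < ∑ a ∈ labelClass f (f i), ∑ b ∈ labelClass f (f j), (1 : ℝ) := by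
          refine sum_lt_sum (fun a _ => sum_le_sum fun b _ => (adj_mem_Icc G a b).2)
            ⟨i, hmem i, ?_⟩
          exact sum_lt_sum (fun b _ => (adj_mem_Icc G i b).2) ⟨j, hmem j, by simp [adj, hij]⟩
      _ = _ := by simp
  have hfac : ∀ e ∈ edges (⊤ : SimpleGraph (Fin n)),
      0 < if e ∈ edges G then symFun p e else 1 - symFun p e := by
    intro e _
    induction e with | h i j =>
    rw [hsymm]
    split_ifs with h
    · exact hpos i j (by simpa [mem_edges] using h)
    · exact sub_pos.2 (hlt i j (by simpa [mem_edges] using h))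
  rw [bernWeight, ← Real.exp_log (prod_pos hfac), Real.exp_le_exp,
    Real.log_prod fun e he => (hfac e he).ne']
  have h2 := two_mul_sum_edges_top fun e =>
    Real.log (if e ∈ edges G then symFun p e else 1 - symFun p e)
  have h3 : ∑ i, ∑ j, (adj G i j * (Real.log (p i j) - Real.log (1 - p i j)) + Real.log (1 - p i j))
      ≤ ∑ i, ∑ j, if i ≠ j then Real.log (if s(i, j) ∈ edges G then symFun p s(i, j)
        else 1 - symFun p s(i, j)) else 0 := by
    refine sum_le_sum fun i _ => sum_le_sum fun j _ => ?_
    have hmem' : s(i, j) ∈ edges G ↔ G.Adj i j := by simp [mem_edges]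
    simp only [hsymm, hmem', adj]
    by_cases hij : i = j
    · subst hij
      simp only [SimpleGraph.irrefl, if_false, zero_mul, zero_add, ne_eq, not_true_eq_false]
      exact Real.log_nonpos (sub_nonneg.2 (hpI i i).2) (by linarith [(hpI i i).1])
    · by_cases hG : G.Adj i j <;> simp [hij, hG]
  have h4 : ∑ i, ∑ j, (adj G i j * (Real.log (p i j) - Real.log (1 - p i j)) + Real.log (1 - p i j))
      = -∑ i, ∑ j, Real.binEntropy (p i j) := by
    have := sum_adj_mul_label G f fun a b =>
      Real.log (G.edgeDensity (labelClass f a) (labelClass f b) : ℝ)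
        - Real.log (1 - (G.edgeDensity (labelClass f a) (labelClass f b) : ℝ))
    have h5 : ∑ i, ∑ j, adj G i j * (Real.log (p i j) - Real.log (1 - p i j))
        = ∑ i, ∑ j, p i j * (Real.log (p i j) - Real.log (1 - p i j)) := this
    simp only [sum_add_distrib, h5, ← sum_neg_distrib]
    simp only [← sum_add_distrib]
    refine sum_congr rfl fun i _ => sum_congr rfl fun j _ => ?_
    rw [Real.binEntropy_eq_negMulLog_add_negMulLog_one_sub, Real.negMulLog, Real.negMulLog]
    ring
  linarith

/-! ### Triangle counts -/

/-- The triangles of `G`. -/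
noncomputable def triangles {n : ℕ} (G : SimpleGraph (Fin n)) : Finset (Finset (Fin n)) :=
  {s | G.IsNClique 3 s}

lemma triCount_eq {n : ℕ} (G : SimpleGraph (Fin n)) : triCount G = #(triangles G) := by
  rw [triCount, triangles, Nat.card_eq_fintype_card, Fintype.card_subtype]

/-- Summing over ordered triples counts every triangle six times. -/
lemma six_mul_triCount {n : ℕ} (G : SimpleGraph (Fin n)) :
    6 * (triCount G : ℝ) = ∑ i, ∑ j, ∑ k, adj G i j * adj G j k * adj G i k := by
  set R : Finset (Fin n × Fin n × Fin n) :=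
    {x | G.Adj x.1 x.2.1 ∧ G.Adj x.2.1 x.2.2 ∧ G.Adj x.1 x.2.2} with hR
  have hmaps : ∀ x ∈ R, ({x.1, x.2.1, x.2.2} : Finset (Fin n)) ∈ triangles G := fun x hx => by
    simp only [hR, mem_filter, mem_univ, true_and] at hx
    simp [triangles, SimpleGraph.is3Clique_triple_iff, hx]
  have hfib : ∀ s ∈ triangles G,
      #(R.filter fun x => ({x.1, x.2.1, x.2.2} : Finset (Fin n)) = s) = 6 := by
    intro s hs
    obtain ⟨a, b, c, hab, hac, hbc, rfl⟩ := SimpleGraph.is3Clique_iff.1 (mem_filter.1 hs).2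
    have h1 := hab.ne
    have h2 := hac.ne
    have h3 := hbc.ne
    have : (R.filter fun x => ({x.1, x.2.1, x.2.2} : Finset (Fin n)) = {a, b, c})
        = {(a, b, c), (a, c, b), (b, a, c), (b, c, a), (c, a, b), (c, b, a)} := by
      ext ⟨i, j, k⟩
      simp only [hR, mem_filter, mem_univ, true_and, mem_insert, mem_singleton, Prod.mk.injEq]
      constructor
      · rintro ⟨⟨hij, hjk, hik⟩, h⟩
        have hi : i ∈ ({a, b, c} : Finset (Fin n)) := by rw [← h]; simp
        have hj : j ∈ ({a, b, c} : Finset (Fin n)) := by rw [← h]; simp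
        have hk : k ∈ ({a, b, c} : Finset (Fin n)) := by rw [← h]; simp
        have := hij.ne
        have := hjk.ne
        have := hik.ne
        simp only [mem_insert, mem_singleton] at hi hj hk
        clear h
        grind
      · have hba := hab.symm
        have hca := hac.symm
        have hcb := hbc.symm
        rintro (⟨rfl, rfl, rfl⟩ | ⟨rfl, rfl, rfl⟩ | ⟨rfl, rfl, rfl⟩ | ⟨rfl, rfl, rfl⟩ |
          ⟨rfl, rfl, rfl⟩ | ⟨rfl, rfl, rfl⟩) <;>
        exact ⟨⟨by assumption, by assumption, by assumption⟩, by ext; simp <;> tauto⟩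
    rw [this]
    simp [card_insert_of_notMem, h1, h2, h3, h1.symm, h2.symm, h3.symm]
  have hcard : #R = #(triangles G) * 6 := by
    rw [card_eq_sum_card_fiberwise hmaps, sum_congr rfl hfib, sum_const, smul_eq_mul]
  have hsum : ∑ i, ∑ j, ∑ k, adj G i j * adj G j k * adj G i k = (#R : ℝ) := by
    rw [hR, card_filter, Nat.cast_sum, Fintype.sum_prod_type]
    simp only [Fintype.sum_prod_type]
    refine sum_congr rfl fun i _ => sum_congr rfl fun j _ => sum_congr rfl fun k _ => ?_
    simp only [adj]
    split_ifs <;> simp_all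
  rw [hsum, hcard, triCount_eq]
  push_cast
  ring

lemma six_mul_triCount_div {n : ℕ} (G : SimpleGraph (Fin n)) :
    6 * (triCount G : ℝ) / (n : ℝ) ^ 3 = triDensity (adj G) := by
  rw [six_mul_triCount, triDensity]
  simp only [Fintype.expect_eq_sum_div_card, Fintype.card_fin, ← sum_div, div_div]
  ring

/-! ### Lower bound on the partition function -/

lemma bernWeight_const {n : ℕ} {u : ℝ} (h0 : 0 < u) (h1 : u < 1) (G : SimpleGraph (Fin n)) :
    bernWeight (fun _ => u) G = Real.exp (edgeCount G * Real.log u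
      + ((#(edges (⊤ : SimpleGraph (Fin n))) : ℝ) - edgeCount G) * Real.log (1 - u)) := by
  have hle := card_le_card (edges_subset_top G)
  have hu1 : 0 < 1 - u := sub_pos.2 h1
  rw [bernWeight, prod_ite, filter_mem_eq_inter, inter_eq_right.2 (edges_subset_top G), filter_not,
    filter_mem_eq_inter, inter_eq_right.2 (edges_subset_top G), prod_const, prod_const,
    card_sdiff_of_subset (edges_subset_top G), Real.exp_add, edgeCount_eq, ← Nat.cast_sub hle,
    Real.exp_nat_mul, Real.exp_nat_mul, Real.exp_log h0, Real.exp_log hu1]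

lemma sum_bernWeight_mul_edgeCount {n : ℕ} (u : ℝ) :
    ∑ G : SimpleGraph (Fin n), bernWeight (fun _ => u) G * edgeCount G
      = #(edges (⊤ : SimpleGraph (Fin n))) * u := by
  have h (G : SimpleGraph (Fin n)) : bernWeight (fun _ => u) G * (edgeCount G : ℝ)
      = ∑ e ∈ edges ⊤, if {e} ⊆ edges G then bernWeight (fun _ => u) G else 0 := by
    simp only [singleton_subset_iff]
    rw [← sum_filter, filter_mem_eq_inter, inter_eq_right.2 (edges_subset_top G), sum_const,
      nsmul_eq_mul, edgeCount_eq, mul_comm]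
  rw [sum_congr rfl fun G _ => h G, sum_comm, sum_congr rfl fun e he =>
    sum_bernWeight_of_subset (fun _ => u) (singleton_subset_iff.2 he)]
  simp

lemma sum_bernWeight_mul_triCount {n : ℕ} (u : ℝ) :
    ∑ G : SimpleGraph (Fin n), bernWeight (fun _ => u) G * triCount G = n.choose 3 * u ^ 3 := by
  have h (G : SimpleGraph (Fin n)) : bernWeight (fun _ => u) G * (triCount G : ℝ)
      = ∑ s ∈ powersetCard 3 univ, if s ∈ triangles G then bernWeight (fun _ => u) G else 0 := by
    have hsub : triangles G ⊆ powersetCard 3 univ := fun s hs =>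
      mem_powersetCard.2 ⟨subset_univ _, (mem_filter.1 hs).2.card_eq⟩
    rw [← sum_filter, filter_mem_eq_inter, inter_eq_right.2 hsub, sum_const, nsmul_eq_mul,
      triCount_eq, mul_comm]
  have hs : ∀ s ∈ powersetCard 3 (univ : Finset (Fin n)),
      ∑ G, (if s ∈ triangles G then bernWeight (fun _ => u) G else 0) = u ^ 3 := by
    intro s hs
    obtain ⟨a, b, c, hab, hac, hbc, rfl⟩ := card_eq_three.1 (mem_powersetCard.1 hs).2
    have hiff (G : SimpleGraph (Fin n)) : ({a, b, c} : Finset (Fin n)) ∈ triangles G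
        ↔ ({s(a, b), s(a, c), s(b, c)} : Finset (Sym2 (Fin n))) ⊆ edges G := by
      simp [triangles, SimpleGraph.is3Clique_triple_iff, insert_subset_iff, mem_edges]
    simp only [hiff]
    rw [sum_bernWeight_of_subset, prod_const]
    · congr 1
      rw [card_eq_three]
      refine ⟨_, _, _, ?_, ?_, ?_, rfl⟩ <;> grind [Sym2.eq_iff]
    · simp [insert_subset_iff, mem_edges, hab, hac, hbc]
  rw [sum_congr rfl fun G _ => h G, sum_comm, sum_congr rfl hs]
  simp

lemma six_mul_choose_three (n : ℕ) : 6 * (n.choose 3 : ℝ) = n * (n - 1) * (n - 2) := by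
  rw [Nat.cast_choose_eq_descPochhammer_div]
  simp [descPochhammer_succ_right, Nat.factorial]
  ring

lemma gibbsWeight_pos (α h : ℝ) {n : ℕ} (G : SimpleGraph (Fin n)) : 0 < gibbsWeight α h G :=
  Real.exp_pos _

/-- The constant-density Bernoulli weights witness the variational lower bound for the partition
function. -/
lemma exp_le_sum_gibbsWeight {α h u : ℝ} (hα : 0 < α) (h0 : 0 < u) (h1 : u < 1) {n : ℕ}
    (hn : 0 < n) :
    Real.exp ((n : ℝ) ^ 2 * gFun α h u - (α * u ^ 3 / 2 + |h * u + Real.binEntropy u| / 2) * n)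
      ≤ ∑ G : SimpleGraph (Fin n), gibbsWeight α h G := by
  set D : ℝ := ((#(edges (⊤ : SimpleGraph (Fin n))) : ℕ) : ℝ) with hD
  set L : SimpleGraph (Fin n) → ℝ := fun G => α / n * triCount G + h * edgeCount G
    - (edgeCount G * Real.log u + (D - edgeCount G) * Real.log (1 - u)) with hL
  have hjensen := convexOn_exp.map_sum_le (t := univ) (w := bernWeight (n := n) fun _ => u) (p := L)
    (fun G _ => bernWeight_nonneg (fun _ => ⟨h0.le, h1.le⟩) G) (sum_bernWeight _)
    fun _ _ => Set.mem_univ _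
  have hweight : ∑ G : SimpleGraph (Fin n), bernWeight (fun _ => u) G • Real.exp (L G)
      = ∑ G : SimpleGraph (Fin n), gibbsWeight α h G := by
    refine sum_congr rfl fun G _ => ?_
    rw [bernWeight_const h0 h1, smul_eq_mul, ← Real.exp_add, gibbsWeight, hL]
    congr 1
    ring
  have hmean : ∑ G : SimpleGraph (Fin n), bernWeight (fun _ => u) G • L G
      = α / n * (n.choose 3 * u ^ 3) + D * (h * u + Real.binEntropy u) := by
    have hG (G : SimpleGraph (Fin n)) : bernWeight (fun _ => u) G • L G
        = α / n * (bernWeight (fun _ => u) G * triCount G)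
          + (h - Real.log u + Real.log (1 - u)) * (bernWeight (fun _ => u) G * edgeCount G)
          - D * Real.log (1 - u) * bernWeight (fun _ => u) G := by
      rw [hL, smul_eq_mul]
      ring
    rw [sum_congr rfl fun G _ => hG G, sum_sub_distrib, sum_add_distrib, ← mul_sum, ← mul_sum,
      ← mul_sum, sum_bernWeight_mul_triCount, sum_bernWeight_mul_edgeCount, sum_bernWeight,
      Real.binEntropy_eq_negMulLog_add_negMulLog_one_sub, Real.negMulLog, Real.negMulLog]
    ring
  rw [hweight, hmean] at hjensen
  refine le_trans (Real.exp_le_exp.2 ?_) hjensen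
  have hn' : (0 : ℝ) < n := Nat.cast_pos.2 hn
  have hD2 : D = n * (n - 1) / 2 := by
    have := two_mul_card_edges_top n
    rw [hD]
    linarith
  have hc : α / n * ((n.choose 3 : ℝ) * u ^ 3) = α / 6 * u ^ 3 * ((n - 1) * (n - 2)) := by
    have : (n.choose 3 : ℝ) = n * (n - 1) * (n - 2) / 6 := by
      have := six_mul_choose_three n
      linarith
    rw [this]
    field_simp
  rw [hc, hD2, gFun_eq_binEntropy]
  have hα' : 0 < α * u ^ 3 := by positivity
  have habs := mul_le_mul_of_nonneg_right (le_abs_self (h * u + Real.binEntropy u)) hn'.le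
  nlinarith

/-! ### Upper bound on the weight of a graph -/

lemma gibbsWeight_le {α h δ : ℝ} (hα : 0 < α) {n K : ℕ} [NeZero n] (G : SimpleGraph (Fin n))
    (f : Fin n → Fin K)
    (hδ : |triDensity (adj G) - triDensity (blockAvg G f)| ≤ 3 * δ) :
    gibbsWeight α h G ≤ Real.exp ((n : ℝ) ^ 2 * (energy α h (blockAvg G f) + α * δ / 2))
      * bernWeight (symFun (blockAvg G f)) G := by
  have hn : (n : ℝ) ≠ 0 := Nat.cast_ne_zero.2 (NeZero.ne n)
  have hT : α / n * (triCount G : ℝ) = α / 6 * n ^ 2 * triDensity (adj G) := by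
    rw [← six_mul_triCount_div]
    field_simp
  have hE : h * (edgeCount G : ℝ) = h / 2 * ∑ i, ∑ j, blockAvg G f i j := by
    have h1 := two_mul_edgeCount G
    have h2 := sum_adj_mul_label G f fun _ _ => 1
    simp only [mul_one] at h2
    rw [← h2, ← h1]
    ring
  have hexp (F : Fin n → Fin n → ℝ) :
      (n : ℝ) ^ 2 * (𝔼 i, 𝔼 j, F i j) = ∑ i, ∑ j, F i j := by
    simp only [Fintype.expect_eq_sum_div_card, Fintype.card_fin, ← sum_div]
    field_simp
  have h1 := hexp (blockAvg G f)
  have h2 := hexp fun i j => Real.binEntropy (blockAvg G f i j)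
  refine le_trans ?_ (mul_le_mul_of_nonneg_left (exp_neg_entropy_le_bernWeight G f)
    (Real.exp_pos _).le)
  rw [← Real.exp_add, gibbsWeight, Real.exp_le_exp, hT, hE, energy, ← h1, ← h2]
  have h3 := mul_le_mul_of_nonneg_left (abs_le.1 hδ).2
    (by positivity : 0 ≤ α / 6 * (n : ℝ) ^ 2)
  linarith

/-! ### Counting block averages -/

/-- A finite set of matrices with entries in `[0, 1]` containing every block average over at most
`K` labels. -/
noncomputable def blockMatrices (n K : ℕ) : Finset (Fin n → Fin n → ℝ) :=
  {p ∈ univ.image fun x : (Fin n → Fin K) × (Fin K → Fin K → Fin (n ^ 2 + 1)) => fun i j =>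
    ((x.2 (x.1 i) (x.1 j) : ℕ) : ℝ) / (#(labelClass x.1 (x.1 i)) * #(labelClass x.1 (x.1 j))) |
    ∀ i j, p i j ∈ Set.Icc (0 : ℝ) 1}

lemma blockAvg_mem_blockMatrices {n K : ℕ} (G : SimpleGraph (Fin n)) (f : Fin n → Fin K) :
    blockAvg G f ∈ blockMatrices n K := by
  have hle (S T : Finset (Fin n)) : #(G.interedges S T) < n ^ 2 + 1 := by
    have h1 := G.card_interedges_le_mul S T
    have h2 := Nat.mul_le_mul (card_le_univ S) (card_le_univ T)
    rw [Fintype.card_fin] at h2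
    nlinarith
  refine mem_filter.2 ⟨mem_image.2 ⟨(f, fun a b => ⟨_, hle (labelClass f a) (labelClass f b)⟩),
    mem_univ _, ?_⟩, blockAvg_mem_Icc G f⟩
  ext i j
  simp [blockAvg, SimpleGraph.edgeDensity_def]

lemma card_blockMatrices_le (n K : ℕ) :
    (#(blockMatrices n K) : ℝ) ≤ Real.exp ((K + 2 * K ^ 2) * n) := by
  have hcard : #(blockMatrices n K) ≤ K ^ n * ((n ^ 2 + 1) ^ K) ^ K := by
    refine (card_filter_le _ _).trans (card_image_le.trans_eq ?_)
    simp
  have h1 : (K : ℝ) ≤ Real.exp K := by linarith [Real.add_one_le_exp (K : ℝ)]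
  have h2 : (n : ℝ) ^ 2 + 1 ≤ Real.exp (2 * n) := by
    have h3 := pow_le_pow_left₀ (by positivity) (Real.add_one_le_exp (n : ℝ)) 2
    rw [← Real.exp_nat_mul] at h3
    push_cast at h3
    nlinarith [(Nat.cast_nonneg n : (0 : ℝ) ≤ n)]
  calc (#(blockMatrices n K) : ℝ) ≤ (K : ℝ) ^ n * (((n : ℝ) ^ 2 + 1) ^ K) ^ K := by
        exact_mod_cast hcard
    _ ≤ Real.exp K ^ n * (Real.exp (2 * n) ^ K) ^ K := by gcongr
    _ = _ := by
        rw [← Real.exp_nat_mul, ← Real.exp_nat_mul, ← Real.exp_nat_mul, ← Real.exp_add]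
        congr 1
        ring

lemma symFun_mem_Icc {n : ℕ} {p : Fin n → Fin n → ℝ} (hp : ∀ i j, p i j ∈ Set.Icc (0 : ℝ) 1)
    (e : Sym2 (Fin n)) : symFun p e ∈ Set.Icc (0 : ℝ) 1 := by
  induction e with | h i j =>
  obtain ⟨h1, h2⟩ := hp i j
  obtain ⟨h3, h4⟩ := hp j i
  simp only [symFun, Sym2.lift_mk]
  exact ⟨by linarith, by linarith⟩

/-- If every graph in `A` has weight at most `B` times a Bernoulli weight with block-average
parameters, then the total weight of `A` is at most `B` times the number of such parameters. -/
lemma sum_gibbsWeight_le {α h B : ℝ} {n K : ℕ} (hB : 0 ≤ B) (A : Set (SimpleGraph (Fin n)))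
    (hA : ∀ G ∈ A, ∃ f : Fin n → Fin K,
      gibbsWeight α h G ≤ B * bernWeight (symFun (blockAvg G f)) G) :
    ∑ G : SimpleGraph (Fin n), (if G ∈ A then gibbsWeight α h G else 0)
      ≤ B * Real.exp ((K + 2 * K ^ 2) * n) := by
  have hnonneg : ∀ p ∈ blockMatrices n K, ∀ G, 0 ≤ bernWeight (symFun p) G := fun p hp =>
    bernWeight_nonneg (symFun_mem_Icc (mem_filter.1 hp).2)
  calc ∑ G : SimpleGraph (Fin n), (if G ∈ A then gibbsWeight α h G else 0)
      ≤ ∑ G : SimpleGraph (Fin n), B * ∑ p ∈ blockMatrices n K, bernWeight (symFun p) G := by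
        refine sum_le_sum fun G _ => ?_
        split_ifs with hG
        · obtain ⟨f, hf⟩ := hA G hG
          exact hf.trans (mul_le_mul_of_nonneg_left (single_le_sum
            (f := fun p => bernWeight (symFun p) G) (fun p hp => hnonneg p hp G)
            (blockAvg_mem_blockMatrices G f)) hB)
        · exact mul_nonneg hB (sum_nonneg fun p hp => hnonneg p hp G)
    _ = B * #(blockMatrices n K) := by
        rw [← mul_sum, sum_comm, sum_congr rfl fun p _ => sum_bernWeight (symFun p)]
        simp
    _ ≤ _ := mul_le_mul_of_nonneg_left (card_blockMatrices_le n K) hB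

lemma gibbsProb_eq_one_sub (α h : ℝ) (n : ℕ) (A : Set (SimpleGraph (Fin n))) :
    gibbsProb α h n A = 1 - gibbsProb α h n Aᶜ := by
  have hZ : 0 < ∑ G : SimpleGraph (Fin n), gibbsWeight α h G :=
    sum_pos (fun G _ => gibbsWeight_pos α h G) univ_nonempty
  rw [eq_sub_iff_add_eq, gibbsProb, gibbsProb, ← add_div, ← sum_add_distrib,
    div_eq_one_iff_eq hZ.ne']
  refine sum_congr rfl fun G _ => ?_
  by_cases hG : G ∈ A <;> simp [hG]

/-- Graphs whose triangle density stays away from `u₁ ^ 3` and `u₂ ^ 3` have exponentially small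
total weight compared with `exp (n ^ 2 * gFun α h u₁)`. -/
theorem exists_sum_gibbsWeight_le {α h u₁ u₂ : ℝ} (hα : 0 < α)
    (h0 : 0 < u₁) (h12 : u₁ < u₂) (h1 : u₂ < 1)
    (hmax : ∀ u ∈ Set.Icc (0 : ℝ) 1, gFun α h u ≤ gFun α h u₁)
    (huniq : ∀ u ∈ Set.Icc (0 : ℝ) 1, gFun α h u = gFun α h u₁ → u = u₁ ∨ u = u₂)
    {ε : ℝ} (hε : 0 < ε) :
    ∃ τ > 0, ∃ (C : ℝ) (N : ℕ), ∀ n, N ≤ n → 0 < n → ∀ A : Set (SimpleGraph (Fin n)),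
      (∀ G ∈ A, ε ≤ |6 * (triCount G : ℝ) / (n : ℝ) ^ 3 - u₁ ^ 3| ∧
        ε ≤ |6 * (triCount G : ℝ) / (n : ℝ) ^ 3 - u₂ ^ 3|) →
      ∑ G : SimpleGraph (Fin n), (if G ∈ A then gibbsWeight α h G else 0)
        ≤ Real.exp ((n : ℝ) ^ 2 * (gFun α h u₁ - τ) + C * n) := by
  obtain ⟨τ, hτ, hgap⟩ := exists_energy_gap hα h0 h12 h1 hmax huniq (half_pos hε)
  set δ : ℝ := min (ε / 6) (τ / α) with hδ
  have hδpos : 0 < δ := lt_min (by positivity) (by positivity)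
  have hδε : 3 * δ ≤ ε / 2 := by linarith [min_le_left (ε / 6) (τ / α)]
  have hδτ : α * δ ≤ τ := by
    have := mul_le_mul_of_nonneg_left (min_le_right (ε / 6) (τ / α)) hα.le
    rwa [mul_div_cancel₀ _ hα.ne'] at this
  obtain ⟨K, N, hcut⟩ := exists_label_cut_le hδpos
  refine ⟨τ / 2, half_pos hτ, K + 2 * K ^ 2, N, fun n hN hn A hA => ?_⟩
  have : NeZero n := ⟨hn.ne'⟩
  rw [Real.exp_add]
  refine sum_gibbsWeight_le (Real.exp_pos _).le A fun G hG => ?_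
  obtain ⟨f, hf⟩ := hcut n hN G
  obtain ⟨hG₁, hG₂⟩ := hA G hG
  rw [six_mul_triCount_div] at hG₁ hG₂
  have htri := abs_triDensity_sub_le (adj_mem_Icc G) (blockAvg_mem_Icc G f) hf
  have hfar {c : ℝ} (hc : ε ≤ |triDensity (adj G) - c|) :
      ε / 2 ≤ |triDensity (blockAvg G f) - c| := by
    linarith [abs_sub_le (triDensity (adj G)) (triDensity (blockAvg G f)) c]
  have henergy := hgap n _ (blockAvg_mem_Icc G f) (hfar hG₁) (hfar hG₂)
  refine ⟨f, (gibbsWeight_le hα G f htri).trans ?_⟩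
  refine mul_le_mul_of_nonneg_right (Real.exp_le_exp.2 ?_) (bernWeight_nonneg
    (symFun_mem_Icc (blockAvg_mem_Icc G f)) G)
  exact mul_le_mul_of_nonneg_left (by linarith) (sq_nonneg _)

end

/-- Concentration of the triangle density on the critical curve, where the energy
function has exactly two maximizers `0 < u₁ < u₂ < 1`. -/
theorem edge_triangle_concentration_two_maximizers
    (α h : ℝ) (hα : α > -2) (u₁ u₂ : ℝ)
    (h0 : 0 < u₁) (h12 : u₁ < u₂) (h1 : u₂ < 1)
    (hmax : ∀ u ∈ Set.Icc (0 : ℝ) 1, gFun α h u ≤ gFun α h u₁)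
    (heq : gFun α h u₂ = gFun α h u₁)
    (huniq : ∀ u ∈ Set.Icc (0 : ℝ) 1, gFun α h u = gFun α h u₁ → u = u₁ ∨ u = u₂) :
    ∃ ε₀ > 0, ∀ ε, 0 < ε → ε ≤ ε₀ → ∃ τ > 0, ∃ N : ℕ, ∀ n ≥ N,
      1 - Real.exp (-τ * (n : ℝ) ^ 2) ≤
        gibbsProb α h n
          {G : SimpleGraph (Fin n) | 6 * (triCount G : ℝ) / (n : ℝ) ^ 3 ∈
            Set.Ioo (u₁ ^ 3 - ε) (u₁ ^ 3 + ε) ∪ Set.Ioo (u₂ ^ 3 - ε) (u₂ ^ 3 + ε)} := by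
  have hα₀ := pos_of_two_maximizers h0 h12 h1 hmax heq
  refine ⟨1, one_pos, fun ε hε _ => ?_⟩
  obtain ⟨τ, hτ, C, N, hbad⟩ := exists_sum_gibbsWeight_le hα₀ h0 h12 h1 hmax huniq hε
  set C' : ℝ := α * u₁ ^ 3 / 2 + |h * u₁ + Real.binEntropy u₁| / 2 with hC'
  refine ⟨τ / 2, half_pos hτ, max (max N 1) ⌈(C + C') / (τ / 2)⌉₊, fun n hn => ?_⟩
  have hNn : N ≤ n := ((le_max_left N 1).trans (le_max_left _ _)).trans hn
  have hn1 : 0 < n := ((le_max_right N 1).trans (le_max_left _ _)).trans hn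
  have hlarge : C + C' ≤ τ / 2 * n := by
    rw [← div_le_iff₀' (half_pos hτ)]
    exact (Nat.le_ceil _).trans (Nat.cast_le.2 ((le_max_right _ _).trans hn))
  rw [gibbsProb_eq_one_sub]
  refine sub_le_sub_left ?_ 1
  have hZ := exp_le_sum_gibbsWeight (h := h) hα₀ h0 (h12.trans h1) hn1
  rw [← hC'] at hZ
  rw [gibbsProb, div_le_iff₀ ((Real.exp_pos _).trans_le hZ)]
  refine (hbad n hNn hn1 _ fun G hG => ?_).trans
    (le_trans ?_ (mul_le_mul_of_nonneg_left hZ (Real.exp_pos _).le))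
  · simp only [Set.mem_compl_iff, Set.mem_ofPred_eq, Set.mem_union, not_or, Set.mem_Ioo] at hG
    obtain ⟨hG₁, hG₂⟩ := hG
    constructor
    · by_contra! hlt
      exact hG₁ ⟨by linarith [(abs_lt.1 hlt).1], by linarith [(abs_lt.1 hlt).2]⟩
    · by_contra! hlt
      exact hG₂ ⟨by linarith [(abs_lt.1 hlt).1], by linarith [(abs_lt.1 hlt).2]⟩
  · rw [← Real.exp_add, Real.exp_le_exp]
    have := mul_le_mul_of_nonneg_right hlarge (Nat.cast_nonneg n : (0 : ℝ) ≤ n)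
    linarith
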